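/- arXiv:2405.19911 — 2 statements merged into one kernel-verified Lean document; each statement's English description precedes it below -/
import Mathlib

section
/- Let n be even, let λ ∈ F_{q^n} \ F_{q^2}, let t = [F_{q^2}(λ):F_{q^2}], let 1 ≤ l < t/2, and set S = ⟨1, λ, …, λ^{l−1}⟩_{F_{q^2}} ⊕ λ^l·F_q and S̄ = ⟨1, λ, …, λ^{l−1}⟩_{F_{q^2}}. Then for every μ ∈ F_{q^n}^*: (i) dim_{F_q}(S ∩ μS) = 2l if and only if μ ∈ F_{q^2} \ F_q; (ii) for 0 < r < l, dim_{F_q}(S ∩ μS) = 2(l−r) if and only if μ or μ^{−1} equals p(λ)/q(λ) where p(x) = α_0 + … + α_{r−1}x^{r−1} + x^r and q(x) = β_0 + … + β_r x^r are coprime polynomials over F_{q^2} of degree at most r with β_r ∈ F_{q^2} \ F_q, and in this case S ∩ μS = S̄ ∩ μS̄; (iii) for 0 < r < l, dim_{F_q}(S ∩ μS) = 2(l−r)+1 if and only if μ or μ^{−1} equals p(λ)/q(λ) with p(x), q(x) coprime of the same shape but with β_r ∈ F_q, and in this case dim_{F_q}(S ∩ μS) = dim_{F_q}(S̄ ∩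 μS̄) + 1. Finally, for every r ∈ {1,…,l−1} there exists μ ∈ F_{q^n}^* with dim_{F_q}(S ∩ μS) = 2(l−r), and for every r ∈ {1,…,l} there exists μ ∈ F_{q^n}^* with dim_{F_q}(S ∩ μS) = 2(l−r)+1. -/
/-!
Setting: `q` is a prime power, realized by a finite field `Fq` with `Fintype.card Fq = q`;
`F` plays the role of `F_{q^n}`: a finite field extension of `Fq` with `Module.finrank Fq F = n`.
`F_q`-subspaces of `F_{q^n}` are `Submodule Fq F`; for a divisor `t` of `n`, the subfield
`F_{q^t}` is the (unique) `T : IntermediateField Fq F` with `Module.finrank Fq ↥T = t`, and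
`F_{q^t}`-subspaces are `Submodule ↥T F`.
-/

set_option synthInstance.maxHeartbeats 1000000

namespace FWS

variable (R : Type*) {F : Type*} [Field R] [Field F] [Algebra R F]

/-- The cyclic shift `α S = {α * s : s ∈ S}` of an `R`-subspace `S` of `F`. -/
def shift (α : F) (S : Submodule R F) : Submodule R F :=
  S.map (LinearMap.mulLeft R α)

/-- The subspace distance `d(U,V) = dim U + dim V - 2 dim (U ⊓ V)`
(which is `2k - 2 dim (U ⊓ V)` for `U, V` of the same dimension `k`). -/
noncomputable def sdist (U V : Submodule R F) : ℕ :=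
  Module.finrank R ↥U + Module.finrank R ↥V - 2 * Module.finrank R ↥(U ⊓ V)

/-- The one-orbit cyclic subspace code `Orb(S) = {α S : α ∈ F*}`. -/
def orb (S : Submodule R F) : Set (Submodule R F) :=
  {T | ∃ α : F, α ≠ 0 ∧ T = shift R α S}

/-- The weight `ω_{2i}(Orb(S)) = #{α S : α ∈ F*, d(S, α S) = 2 i}`. -/
noncomputable def omega (S : Submodule R F) (i : ℕ) : ℕ :=
  Nat.card {T : Submodule R F // T ∈ orb R S ∧ sdist R S T = 2 * i}

/-- `Orb(S)` is a full weight spectrum (FWS) code: `ω_{2i} > 0` for all `1 ≤ i ≤ dim S`. -/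
def IsFWS (S : Submodule R F) : Prop :=
  ∀ i : ℕ, 1 ≤ i → i ≤ Module.finrank R ↥S → 0 < omega R S i

/-- The subspace `⟨1, l, ..., l^(k-1)⟩_R` spanned by the first `k` powers of `l`. -/
def polySpan (l : F) (k : ℕ) : Submodule R F :=
  Submodule.span R ((fun i : ℕ => l ^ i) '' Set.Iio k)

/-- The invariant `m(Orb(S))`: the least divisor `t` of `n` such that
`dim_{F_{q^t}} ⟨S⟩_{F_{q^t}} = 1` (equivalently, the degree of the smallest subfield
containing a cyclic shift of `S`). -/
noncomputable def mOrb (S : Submodule R F) : ℕ :=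
  sInf {t : ℕ | t ∣ Module.finrank R F ∧
    ∃ T : IntermediateField R F, Module.finrank R ↥T = t ∧
      Module.finrank ↥T ↥(Submodule.span ↥T (S : Set F)) = 1}

/-- The stabilizer `H(S) = {x ∈ F* : x S = S} ∪ {0}` of a set `S ⊆ F`, as a subset of `F`
(it is a subfield of `F` when `S` is a subspace). -/
def stab {F : Type*} [Field F] (S : Set F) : Set F :=
  {x : F | x ≠ 0 ∧ (fun y => x * y) '' S = S} ∪ {0}

end FWS

namespace FWS

open Polynomial

section TopCoeff

variable {k K F : Type*} [Field k] [Field K] [Field F] [Algebra k K] [Algebra K F] [Algebra k F]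
  [IsScalarTower k K F]

/-- The `k`-linear map `(g, w) ↦ g(x) + w x ^ m` on pairs of a polynomial `g` of degree `< m`
and an element `w` of `W`. -/
noncomputable def topCoeffMap (x : F) (m : ℕ) (W : Submodule k K) :
    (↥((degreeLT K m).restrictScalars k) × ↥W) →ₗ[k] F :=
  LinearMap.coprod
    (((aeval x : K[X] →ₐ[K] F).toLinearMap.restrictScalars k).comp (Submodule.subtype _))
    (((LinearMap.toSpanSingleton K F (x ^ m)).restrictScalars k).comp (Submodule.subtype _))

/-- The `k`-subspace of the values at `x` of the polynomials over `K` of degree at most `m`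
whose coefficient of degree `m` lies in `W`. -/
noncomputable def topCoeffSpan (x : F) (m : ℕ) (W : Submodule k K) : Submodule k F :=
  LinearMap.range (topCoeffMap x m W)

lemma topCoeffMap_apply (x : F) (m : ℕ) (W : Submodule k K)
    (v : ↥((degreeLT K m).restrictScalars k) × ↥W) :
    topCoeffMap x m W v = aeval x ((v.1 : K[X]) + C (v.2 : K) * X ^ m) := by
  simp [topCoeffMap, Algebra.smul_def]

lemma mem_topCoeffSpan {x : F} {m : ℕ} {W : Submodule k K} {y : F} :
    y ∈ topCoeffSpan x m W ↔
      ∃ f : K[X], f.natDegree ≤ m ∧ f.coeff m ∈ W ∧ aeval x f = y := by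
  constructor
  · intro hy
    obtain ⟨⟨⟨g, hg⟩, ⟨w, hw⟩⟩, hv⟩ := LinearMap.mem_range.1 hy
    rw [topCoeffMap_apply] at hv
    have hg' : g.degree < m := mem_degreeLT.1 hg
    refine ⟨g + C w * X ^ m, ?_, ?_, hv⟩
    · exact natDegree_add_le_of_degree_le (natDegree_le_of_degree_le hg'.le)
        (natDegree_C_mul_X_pow_le w m)
    · simpa [coeff_eq_zero_of_degree_lt hg'] using hw
  · rintro ⟨f, hf, hfW, rfl⟩
    have hg : f - C (f.coeff m) * X ^ m ∈ degreeLT K m := by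
      rw [mem_degreeLT, degree_lt_iff_coeff_zero]
      intro j hj
      rcases hj.eq_or_lt with rfl | hj
      · simp
      · simp [coeff_eq_zero_of_natDegree_lt (hf.trans_lt hj), coeff_X_pow, hj.ne']
    have hg' : f - C (f.coeff m) * X ^ m ∈ (degreeLT K m).restrictScalars k := hg
    refine LinearMap.mem_range.2 ⟨(⟨_, hg'⟩, ⟨f.coeff m, hfW⟩), ?_⟩
    rw [topCoeffMap_apply, sub_add_cancel]

lemma finrank_topCoeffSpan [FiniteDimensional k K] {x : F} {m : ℕ}
    (hx : ∀ f : K[X], f.natDegree ≤ m → aeval x f = 0 → f = 0) (W : Submodule k K) :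
    Module.finrank k ↥(topCoeffSpan x m W) = Module.finrank k K * m + Module.finrank k ↥W := by
  have e : Module.finrank k ↥((degreeLT K m).restrictScalars k) = Module.finrank k K * m := by
    have h := Module.finrank_mul_finrank k K ↥(degreeLT K m)
    rw [(degreeLTEquiv K m).finrank_eq, Module.finrank_fin_fun] at h
    exact h.symm
  have : FiniteDimensional K ↥(degreeLT K m) := (degreeLTEquiv K m).symm.finiteDimensional
  have : FiniteDimensional k ↥((degreeLT K m).restrictScalars k) :=
    FiniteDimensional.trans k K ↥(degreeLT K m)
  rw [topCoeffSpan, LinearMap.finrank_range_of_inj, Module.finrank_prod, e]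
  rw [injective_iff_map_eq_zero]
  rintro ⟨⟨g, hg⟩, ⟨w, hw⟩⟩ h
  have hg' : g.degree < m := mem_degreeLT.1 hg
  rw [topCoeffMap_apply] at h
  have h0 := hx _ (natDegree_add_le_of_degree_le (natDegree_le_of_degree_le hg'.le)
    (natDegree_C_mul_X_pow_le w m)) h
  have hw0 : w = 0 := by
    simpa [coeff_eq_zero_of_degree_lt hg'] using congrArg (fun f => coeff f m) h0
  subst hw0
  have hg0 : g = 0 := by simpa using h0
  subst hg0
  rfl

lemma mem_shift {μ : F} {S : Submodule k F} {y : F} :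
    y ∈ shift k μ S ↔ ∃ s ∈ S, μ * s = y := by
  simp [shift, Submodule.mem_map]

lemma finrank_shift {μ : F} (hμ : μ ≠ 0) (S : Submodule k F) :
    Module.finrank k ↥(shift k μ S) = Module.finrank k ↥S :=
  (Submodule.equivMapOfInjective _ (mul_right_injective₀ hμ) S).finrank_eq.symm

lemma inf_shift_eq_shift_inv {μ : F} (hμ : μ ≠ 0) (S : Submodule k F) :
    S ⊓ shift k μ S = shift k μ (S ⊓ shift k μ⁻¹ S) := by
  ext y
  simp only [Submodule.mem_inf, mem_shift]
  constructor
  · rintro ⟨hy, s, hs, rfl⟩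
    exact ⟨s, ⟨hs, _, hy, inv_mul_cancel_left₀ hμ s⟩, rfl⟩
  · rintro ⟨_, ⟨hs, s, hs', rfl⟩, rfl⟩
    rw [mul_inv_cancel_left₀ hμ]
    exact ⟨hs', _, hs, mul_inv_cancel_left₀ hμ s⟩

lemma topCoeffSpan_inf_shift {x : F} {l r : ℕ} (hr : r ≤ l)
    (hx : ∀ f : K[X], f.natDegree ≤ 2 * l → aeval x f = 0 → f = 0) {p p' : K[X]}
    (hpp : IsCoprime p p') (hp : p.Monic) (hpr : p.natDegree = r) (hp' : p'.natDegree ≤ r)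
    {μ : F} (hμ : μ ≠ 0) (hμp : μ = aeval x p / aeval x p') (W : Submodule k K) :
    topCoeffSpan x l W ⊓ shift k μ (topCoeffSpan x l W) =
      shift k (aeval x p)
        (topCoeffSpan x (l - r) (W ⊓ W.comap (LinearMap.mulRight k (p'.coeff r)))) := by
  have hp'0 : aeval x p' ≠ 0 := by
    rintro h
    exact hμ (by rw [hμp, h, div_zero])
  have htop (h : K[X]) (hh : h.natDegree ≤ l - r) (s : K[X]) (hs : s.natDegree ≤ r) :
      (h * s).natDegree ≤ l ∧ (h * s).coeff l = h.coeff (l - r) * s.coeff r := by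
    refine ⟨natDegree_mul_le.trans (by omega), ?_⟩
    have := coeff_mul_add_eq_of_natDegree_le hh hs
    rwa [Nat.sub_add_cancel hr] at this
  have hpc : p.coeff r = 1 := by rw [← hpr]; exact hp
  ext y
  simp only [Submodule.mem_inf, mem_shift, mem_topCoeffSpan, Submodule.mem_comap,
    LinearMap.mulRight_apply]
  constructor
  · rintro ⟨⟨f, hf, hfW, rfl⟩, _, ⟨g, hg, hgW, rfl⟩, hfg⟩
    have heq : f * p' = p * g := by
      refine sub_eq_zero.1 (hx _ ?_ ?_)
      · refine (natDegree_sub_le _ _).trans (max_le ?_ ?_)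
        · exact natDegree_mul_le.trans (by omega)
        · exact natDegree_mul_le.trans (by omega)
      · rw [map_sub, map_mul, map_mul, ← hfg, hμp]
        field_simp
        ring
    obtain ⟨h, rfl⟩ := hpp.dvd_of_dvd_mul_right (Dvd.intro _ heq.symm)
    have hgh : g = h * p' := by
      apply mul_left_cancel₀ hp.ne_zero
      rw [← heq, mul_assoc]
    rw [mul_comm p h] at hf hfW
    have hh : h.natDegree ≤ l - r := by
      by_cases h0 : h = 0
      · simp [h0]
      · rw [mul_comm, hp.natDegree_mul' h0] at hf
        omega
    rw [(htop h hh p hpr.le).2, hpc, mul_one] at hfW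
    rw [hgh, (htop h hh p' hp').2] at hgW
    exact ⟨_, ⟨h, hh, ⟨hfW, hgW⟩, rfl⟩, (map_mul _ _ _).symm⟩
  · rintro ⟨_, ⟨h, hh, ⟨hfW, hgW⟩, rfl⟩, rfl⟩
    obtain ⟨h1, h2⟩ := htop h hh p hpr.le
    obtain ⟨h3, h4⟩ := htop h hh p' hp'
    refine ⟨⟨h * p, h1, ?_, ?_⟩, _, ⟨h * p', h3, ?_, rfl⟩, ?_⟩
    · rwa [h2, hpc, mul_one]
    · rw [map_mul, mul_comm]
    · rwa [h4]
    · rw [map_mul, hμp]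
      field_simp

lemma exists_monic_of_natDegree_le {x : F} {f g : K[X]} (hfg : IsCoprime f g) (hf : f ≠ 0)
    (hgf : g.natDegree ≤ f.natDegree) :
    ∃ p p' : K[X], IsCoprime p p' ∧ p.Monic ∧ p.natDegree = f.natDegree ∧
      p'.natDegree ≤ f.natDegree ∧ aeval x f / aeval x g = aeval x p / aeval x p' := by
  have ha : f.leadingCoeff⁻¹ ≠ 0 := inv_ne_zero (leadingCoeff_ne_zero.2 hf)
  have hu : IsUnit (C f.leadingCoeff⁻¹) := isUnit_C.2 ha.isUnit
  refine ⟨C f.leadingCoeff⁻¹ * f, C f.leadingCoeff⁻¹ * g, (isCoprime_mul_unit_left hu _ _).2 hfg,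
    ?_, natDegree_C_mul ha, (natDegree_C_mul ha).trans_le hgf, ?_⟩
  · rw [mul_comm]
    exact monic_mul_leadingCoeff_inv hf
  · have : algebraMap K F f.leadingCoeff⁻¹ ≠ 0 := by simpa using ha
    rw [map_mul, map_mul, aeval_C, mul_div_mul_left _ _ this]

lemma exists_isCoprime_of_inf_shift_ne_bot {x : F} {l : ℕ} {μ : F}
    {W : Submodule k K} (h : topCoeffSpan x l W ⊓ shift k μ (topCoeffSpan x l W) ≠ ⊥) :
    ∃ r ≤ l, ∃ p p' : K[X], IsCoprime p p' ∧ p.Monic ∧ p.natDegree = r ∧ p'.natDegree ≤ r ∧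
      (μ = aeval x p / aeval x p' ∨ μ⁻¹ = aeval x p / aeval x p') := by
  classical
  obtain ⟨y, hy, hy0⟩ := Submodule.exists_mem_ne_zero_of_ne_bot h
  simp only [Submodule.mem_inf, mem_shift, mem_topCoeffSpan] at hy
  obtain ⟨⟨f, hf, -, rfl⟩, _, ⟨g, hg, -, rfl⟩, hfg⟩ := hy
  have hf0 : f ≠ 0 := by rintro rfl; simp at hy0
  have hgx : aeval x g ≠ 0 := by intro h; simp [h] at hfg; exact hy0 hfg.symm
  have hg0 : g ≠ 0 := by rintro rfl; simp at hgx
  obtain ⟨d, f', g', hco, rfl, rfl⟩ : ∃ d f' g' : K[X], IsCoprime f' g' ∧ f = d * f' ∧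
      g = d * g' := by
    let := EuclideanDomain.gcdMonoid K[X]
    have hd : gcd f g ≠ 0 := fun h => hg0 (((gcd_eq_zero_iff f g).1 h).2)
    exact ⟨gcd f g, f / gcd f g, g / gcd f g, isCoprime_div_gcd_div_gcd hg0,
      (EuclideanDomain.mul_div_cancel' hd (gcd_dvd_left f g)).symm,
      (EuclideanDomain.mul_div_cancel' hd (gcd_dvd_right f g)).symm⟩
  rw [map_mul] at hgx hy0
  have hμ : μ = aeval x f' / aeval x g' := by
    rw [map_mul, map_mul] at hfg
    rw [eq_div_iff (right_ne_zero_of_mul hgx)]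
    apply mul_left_cancel₀ (left_ne_zero_of_mul hgx)
    rw [← hfg]; ring
  have hd : d ≠ 0 := left_ne_zero_of_mul hf0
  have hf' : f' ≠ 0 := right_ne_zero_of_mul hf0
  have hg' : g' ≠ 0 := right_ne_zero_of_mul hg0
  rw [natDegree_mul hd hf'] at hf
  rw [natDegree_mul hd hg'] at hg
  rcases le_total g'.natDegree f'.natDegree with hle | hle
  · obtain ⟨p, p', h1, h2, h3, h4, h5⟩ := exists_monic_of_natDegree_le (x := x) hco hf' hle
    exact ⟨f'.natDegree, by omega, p, p', h1, h2, h3, h4, Or.inl (hμ.trans h5)⟩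
  · obtain ⟨p, p', h1, h2, h3, h4, h5⟩ := exists_monic_of_natDegree_le (x := x) hco.symm hg' hle
    refine ⟨g'.natDegree, by omega, p, p', h1, h2, h3, h4, Or.inr ?_⟩
    rw [hμ, inv_div, h5]

lemma one_inf_comap_mulRight_of_mem {b : K} (hb : b ∈ (1 : Submodule k K)) :
    (1 : Submodule k K) ⊓ (1 : Submodule k K).comap (LinearMap.mulRight k b) = 1 := by
  rw [inf_eq_left]
  intro c hc
  simpa using Submodule.mul_mem_mul hc hb

lemma one_inf_comap_mulRight_of_notMem {b : K} (hb : b ∉ (1 : Submodule k K)) :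
    (1 : Submodule k K) ⊓ (1 : Submodule k K).comap (LinearMap.mulRight k b) = ⊥ := by
  rw [eq_bot_iff]
  rintro c ⟨hc, hcb⟩
  obtain ⟨a, rfl⟩ := Submodule.mem_one.1 hc
  obtain ⟨a', ha'⟩ := Submodule.mem_one.1 hcb
  rw [Submodule.mem_bot]
  by_contra h0
  refine hb (Submodule.mem_one.2 ⟨a' / a, ?_⟩)
  rw [map_div₀, ha', LinearMap.mulRight_apply, mul_div_cancel_left₀ _ h0]

/-- The intersections with the shifts by `μ` of the spaces of values of polynomials of degree at
most `l` with top coefficient in `k`, respectively of degree less than `l`. -/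
lemma topCoeffSpan_inf_shift_dichotomy [FiniteDimensional k K] {x : F} {l r : ℕ} (hr : r ≤ l)
    (hx : ∀ f : K[X], f.natDegree ≤ 2 * l → aeval x f = 0 → f = 0) {p p' : K[X]}
    (hpp : IsCoprime p p') (hp : p.Monic) (hpr : p.natDegree = r) (hp' : p'.natDegree ≤ r)
    {μ : F} (hμ : μ ≠ 0) (hμp : μ = aeval x p / aeval x p' ∨ μ⁻¹ = aeval x p / aeval x p') :
    Module.finrank k ↥(topCoeffSpan x l (⊥ : Submodule k K) ⊓
        shift k μ (topCoeffSpan x l (⊥ : Submodule k K))) = Module.finrank k K * (l - r) ∧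
    (p'.coeff r ∈ (1 : Submodule k K) →
      Module.finrank k ↥(topCoeffSpan x l (1 : Submodule k K) ⊓
        shift k μ (topCoeffSpan x l (1 : Submodule k K))) = Module.finrank k K * (l - r) + 1) ∧
    (p'.coeff r ∉ (1 : Submodule k K) →
      topCoeffSpan x l (1 : Submodule k K) ⊓ shift k μ (topCoeffSpan x l (1 : Submodule k K)) =
        topCoeffSpan x l (⊥ : Submodule k K) ⊓
          shift k μ (topCoeffSpan x l (⊥ : Submodule k K))) := by
  wlog hμp' : μ = aeval x p / aeval x p' generalizing μ
  · have h := this (inv_ne_zero hμ) (Or.inl (hμp.resolve_left hμp')) (hμp.resolve_left hμp')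
    rw [inf_shift_eq_shift_inv hμ (topCoeffSpan x l ⊥),
      inf_shift_eq_shift_inv hμ (topCoeffSpan x l 1), finrank_shift hμ, finrank_shift hμ]
    exact ⟨h.1, h.2.1, fun hb => congrArg _ (h.2.2 hb)⟩
  have hpx : aeval x p ≠ 0 := by
    intro h
    exact hμ (by rw [hμp', h, zero_div])
  have hx' (f : K[X]) (hf : f.natDegree ≤ l - r) (h : aeval x f = 0) : f = 0 :=
    hx f (by omega) h
  have key := topCoeffSpan_inf_shift (k := k) hr hx hpp hp hpr hp' hμ hμp'
  rw [key ⊥, key 1, bot_inf_eq]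
  refine ⟨?_, fun hb => ?_, fun hb => ?_⟩
  · rw [finrank_shift hpx, finrank_topCoeffSpan hx', finrank_bot, add_zero]
  · rw [one_inf_comap_mulRight_of_mem hb, finrank_shift hpx, finrank_topCoeffSpan hx',
      Submodule.one_eq_span, finrank_span_singleton one_ne_zero]
  · rw [one_inf_comap_mulRight_of_notMem hb]

lemma polySpan_restrictScalars (x : F) (l : ℕ) :
    (polySpan K x l).restrictScalars k = topCoeffSpan x l (⊥ : Submodule k K) := by
  classical
  ext y
  have h : polySpan K x l = (degreeLT K l).map (aeval x : K[X] →ₐ[K] F).toLinearMap := by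
    rw [degreeLT_eq_span_X_pow, Submodule.map_span, polySpan]
    congr 1
    ext z
    simp
  rw [Submodule.restrictScalars_mem, h, mem_topCoeffSpan]
  simp only [Submodule.mem_map, mem_degreeLT, Submodule.mem_bot]
  refine exists_congr fun f => ?_
  rw [← and_assoc]
  refine and_congr ?_ Iff.rfl
  constructor
  · intro hf
    exact ⟨natDegree_le_of_degree_le hf.le, coeff_eq_zero_of_degree_lt hf⟩
  · rintro ⟨hf, hf0⟩
    rw [degree_lt_iff_coeff_zero]
    intro j hj
    rcases hj.eq_or_lt with rfl | hj
    · exact hf0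
    · exact coeff_eq_zero_of_natDegree_lt (hf.trans_lt hj)

lemma topCoeffSpan_one (x : F) (l : ℕ) :
    topCoeffSpan x l (1 : Submodule k K) =
      (polySpan K x l).restrictScalars k ⊔ Submodule.span k {x ^ l} := by
  rw [polySpan_restrictScalars]
  ext y
  rw [Submodule.mem_sup]
  simp only [mem_topCoeffSpan, Submodule.mem_bot, Submodule.mem_span_singleton]
  constructor
  · rintro ⟨f, hf, hf1, rfl⟩
    obtain ⟨a, ha⟩ := Submodule.mem_one.1 hf1
    refine ⟨_, ⟨f - C (algebraMap k K a) * X ^ l, ?_, ?_, rfl⟩, _, ⟨a, rfl⟩, ?_⟩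
    · exact (natDegree_sub_le _ _).trans (max_le hf (natDegree_C_mul_X_pow_le _ _))
    · simp [ha]
    · simp [Algebra.smul_def, ← IsScalarTower.algebraMap_apply]
  · rintro ⟨_, ⟨f, hf, hf1, rfl⟩, _, ⟨a, rfl⟩, rfl⟩
    refine ⟨f + C (algebraMap k K a) * X ^ l, ?_, ?_, ?_⟩
    · exact natDegree_add_le_of_degree_le hf (natDegree_C_mul_X_pow_le _ _)
    · simp [hf1, Submodule.mem_one]
    · simp [Algebra.smul_def, ← IsScalarTower.algebraMap_apply]

end TopCoeff

end FWS

open FWS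

/-- Proposition 4.8: the intersections of
`S = ⟨1, λ, …, λ^(l-1)⟩_{F_{q^2}} ⊕ λ^l F_q` with its cyclic shifts. -/
theorem family2_shift_intersections
    {Fq F : Type*} [Field Fq] [Field F] [Algebra Fq F] [Fintype Fq] [Fintype F]
    (q n : ℕ) (hq : Fintype.card Fq = q) (hn : Module.finrank Fq F = n) (hneven : Even n)
    (T2 : IntermediateField Fq F) (hT2 : Module.finrank Fq ↥T2 = 2)
    (lam : F) (hlam : lam ∉ T2)
    (t : ℕ) (ht : Module.finrank ↥T2 ↥(IntermediateField.adjoin ↥T2 {lam}) = t)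
    (l : ℕ) (hl : 1 ≤ l) (hlt : 2 * l < t)
    (Sbar : Submodule ↥T2 F) (hSbar : Sbar = polySpan ↥T2 lam l)
    (S : Submodule Fq F)
    (hS : S = Sbar.restrictScalars Fq ⊔ Submodule.span Fq {lam ^ l}) :
    -- (i)
    (∀ μ : F, μ ≠ 0 →
      (Module.finrank Fq ↥(S ⊓ shift Fq μ S) = 2 * l ↔
        (μ ∈ T2 ∧ μ ∉ Set.range (algebraMap Fq F)))) ∧
    -- (ii)
    (∀ μ : F, μ ≠ 0 → ∀ r : ℕ, 0 < r → r < l →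
      ((Module.finrank Fq ↥(S ⊓ shift Fq μ S) = 2 * (l - r) ↔
        ∃ p p' : Polynomial ↥T2, IsCoprime p p' ∧
          p.Monic ∧ p.natDegree = r ∧ p'.natDegree ≤ r ∧
          ((p'.coeff r : F) ∉ Set.range (algebraMap Fq F)) ∧
          (μ = Polynomial.aeval lam p / Polynomial.aeval lam p' ∨
           μ⁻¹ = Polynomial.aeval lam p / Polynomial.aeval lam p')) ∧
       (Module.finrank Fq ↥(S ⊓ shift Fq μ S) = 2 * (l - r) →
         S ⊓ shift Fq μ S = (Sbar ⊓ shift ↥T2 μ Sbar).restrictScalars Fq))) ∧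
    -- (iii)
    (∀ μ : F, μ ≠ 0 → ∀ r : ℕ, 0 < r → r < l →
      ((Module.finrank Fq ↥(S ⊓ shift Fq μ S) = 2 * (l - r) + 1 ↔
        ∃ p p' : Polynomial ↥T2, IsCoprime p p' ∧
          p.Monic ∧ p.natDegree = r ∧ p'.natDegree ≤ r ∧
          ((p'.coeff r : F) ∈ Set.range (algebraMap Fq F)) ∧
          (μ = Polynomial.aeval lam p / Polynomial.aeval lam p' ∨
           μ⁻¹ = Polynomial.aeval lam p / Polynomial.aeval lam p')) ∧
       (Module.finrank Fq ↥(S ⊓ shift Fq μ S) = 2 * (l - r) + 1 →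
         Module.finrank Fq ↥(S ⊓ shift Fq μ S) =
           Module.finrank Fq ↥((Sbar ⊓ shift ↥T2 μ Sbar).restrictScalars Fq) + 1))) ∧
    -- existence of all the above intersection dimensions
    (∀ r : ℕ, 1 ≤ r → r ≤ l - 1 →
      ∃ μ : F, μ ≠ 0 ∧ Module.finrank Fq ↥(S ⊓ shift Fq μ S) = 2 * (l - r)) ∧
    (∀ r : ℕ, 1 ≤ r → r ≤ l →
      ∃ μ : F, μ ≠ 0 ∧ Module.finrank Fq ↥(S ⊓ shift Fq μ S) = 2 * (l - r) + 1) := by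
  have hx (f : Polynomial ↥T2) (hf : f.natDegree ≤ 2 * l) (h0 : Polynomial.aeval lam f = 0) :
      f = 0 := by
    by_contra hne
    have h1 := Polynomial.natDegree_le_natDegree (minpoly.degree_le_of_ne_zero ↥T2 lam hne h0)
    rw [IntermediateField.adjoin.finrank (Algebra.IsIntegral.isIntegral lam)] at ht
    omega
  have hmem (b : ↥T2) :
      (b : F) ∈ Set.range (algebraMap Fq F) ↔ b ∈ (1 : Submodule Fq ↥T2) := by
    rw [Submodule.mem_one]
    exact exists_congr fun a => ⟨fun h => Subtype.ext h, fun h => congrArg Subtype.val h⟩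
  have hSbar' (μ : F) : (Sbar ⊓ shift ↥T2 μ Sbar).restrictScalars Fq =
      topCoeffSpan lam l (⊥ : Submodule Fq ↥T2) ⊓
        shift Fq μ (topCoeffSpan lam l (⊥ : Submodule Fq ↥T2)) := by
    rw [← polySpan_restrictScalars (k := Fq), ← hSbar]
    rfl
  have hS' : S = topCoeffSpan lam l (1 : Submodule Fq ↥T2) := by
    rw [hS, hSbar, topCoeffSpan_one]
  have dich {r : ℕ} (hr : r ≤ l) {p p' : Polynomial ↥T2} (hpp : IsCoprime p p') (hp : p.Monic)
      (hpr : p.natDegree = r) (hp' : p'.natDegree ≤ r) {μ : F} (hμ : μ ≠ 0)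
      (hμp : μ = Polynomial.aeval lam p / Polynomial.aeval lam p' ∨
        μ⁻¹ = Polynomial.aeval lam p / Polynomial.aeval lam p') :
      Module.finrank Fq ↥((Sbar ⊓ shift ↥T2 μ Sbar).restrictScalars Fq) = 2 * (l - r) ∧
      ((p'.coeff r : F) ∈ Set.range (algebraMap Fq F) →
        Module.finrank Fq ↥(S ⊓ shift Fq μ S) = 2 * (l - r) + 1) ∧
      ((p'.coeff r : F) ∉ Set.range (algebraMap Fq F) →
        S ⊓ shift Fq μ S = (Sbar ⊓ shift ↥T2 μ Sbar).restrictScalars Fq) := by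
    rw [hmem, hSbar', hS', ← hT2]
    exact topCoeffSpan_inf_shift_dichotomy hr hx hpp hp hpr hp' hμ hμp
  have rep {μ : F} (h : 0 < Module.finrank Fq ↥(S ⊓ shift Fq μ S)) :
      ∃ r ≤ l, ∃ p p' : Polynomial ↥T2, IsCoprime p p' ∧ p.Monic ∧ p.natDegree = r ∧
        p'.natDegree ≤ r ∧ (μ = Polynomial.aeval lam p / Polynomial.aeval lam p' ∨
          μ⁻¹ = Polynomial.aeval lam p / Polynomial.aeval lam p') := by
    rw [hS'] at h
    refine exists_isCoprime_of_inf_shift_ne_bot (k := Fq) (W := 1) fun h0 => ?_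
    rw [h0, finrank_bot] at h
    exact h.false
  have even_case {μ : F} (hμ : μ ≠ 0) {r : ℕ} (hr : r < l)
      (h : Module.finrank Fq ↥(S ⊓ shift Fq μ S) = 2 * (l - r)) :
      ∃ p p' : Polynomial ↥T2, IsCoprime p p' ∧ p.Monic ∧ p.natDegree = r ∧ p'.natDegree ≤ r ∧
        ((p'.coeff r : F) ∉ Set.range (algebraMap Fq F)) ∧
        (μ = Polynomial.aeval lam p / Polynomial.aeval lam p' ∨
          μ⁻¹ = Polynomial.aeval lam p / Polynomial.aeval lam p') := by
    obtain ⟨s, hs, p, p', hpp, hp, hps, hp', hμp⟩ := rep (μ := μ) (by omega)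
    obtain ⟨h1, h2, h3⟩ := dich hs hpp hp hps hp' hμ hμp
    by_cases hb : (p'.coeff s : F) ∈ Set.range (algebraMap Fq F)
    · have := h2 hb
      omega
    · rw [h3 hb, h1] at h
      obtain rfl : s = r := by omega
      exact ⟨p, p', hpp, hp, hps, hp', hb, hμp⟩
  have odd_case {μ : F} (hμ : μ ≠ 0) {r : ℕ} (hr : r < l)
      (h : Module.finrank Fq ↥(S ⊓ shift Fq μ S) = 2 * (l - r) + 1) :
      ∃ p p' : Polynomial ↥T2, IsCoprime p p' ∧ p.Monic ∧ p.natDegree = r ∧ p'.natDegree ≤ r ∧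
        ((p'.coeff r : F) ∈ Set.range (algebraMap Fq F)) ∧
        (μ = Polynomial.aeval lam p / Polynomial.aeval lam p' ∨
          μ⁻¹ = Polynomial.aeval lam p / Polynomial.aeval lam p') := by
    obtain ⟨s, hs, p, p', hpp, hp, hps, hp', hμp⟩ := rep (μ := μ) (by omega)
    obtain ⟨h1, h2, h3⟩ := dich hs hpp hp hps hp' hμ hμp
    by_cases hb : (p'.coeff s : F) ∈ Set.range (algebraMap Fq F)
    · rw [h2 hb] at h
      obtain rfl : s = r := by omega
      exact ⟨p, p', hpp, hp, hps, hp', hb, hμp⟩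
    · rw [h3 hb, h1] at h
      omega
  have inv_mem {a : F} (h : a⁻¹ ∈ Set.range (algebraMap Fq F)) :
      a ∈ Set.range (algebraMap Fq F) := by
    obtain ⟨c, hc⟩ := h
    exact ⟨c⁻¹, by rw [map_inv₀, hc, inv_inv]⟩
  refine ⟨fun μ hμ => ⟨fun h => ?_, ?_⟩, fun μ hμ r hr0 hrl => ⟨⟨even_case hμ hrl, ?_⟩, ?_⟩,
    fun μ hμ r hr0 hrl => ⟨⟨odd_case hμ hrl, ?_⟩, ?_⟩, fun r hr1 hrl => ?_, fun r hr1 hrl => ?_⟩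
  · obtain ⟨p, p', -, hp, hpr, hp', hb, hμp⟩ := even_case hμ (r := 0) (by omega) (by simpa using h)
    obtain rfl : p = 1 := Polynomial.eq_one_of_monic_natDegree_zero hp hpr
    obtain ⟨c, rfl⟩ := Polynomial.natDegree_eq_zero.1 (Nat.le_zero.1 hp')
    rw [Polynomial.coeff_C_zero] at hb
    rw [map_one, Polynomial.aeval_C, one_div, inv_inj] at hμp
    rcases hμp with rfl | rfl
    · exact ⟨T2.inv_mem c.2, fun h => hb (inv_mem h)⟩
    · exact ⟨c.2, hb⟩
  · rintro ⟨hμT, hμb⟩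
    obtain ⟨h1, -, h3⟩ := dich (Nat.zero_le l) (p := 1) (p' := Polynomial.C ⟨μ, hμT⟩)
      isCoprime_one_left Polynomial.monic_one Polynomial.natDegree_one
      (Polynomial.natDegree_C _).le hμ (Or.inr (by
        rw [map_one, Polynomial.aeval_C, one_div]
        rfl))
    rw [h3 (by rwa [Polynomial.coeff_C_zero]), h1, Nat.sub_zero]
  · rintro ⟨p, p', hpp, hp, hpr, hp', hb, hμp⟩
    obtain ⟨h1, -, h3⟩ := dich hrl.le hpp hp hpr hp' hμ hμp
    rw [h3 hb, h1]
  · intro h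
    obtain ⟨p, p', hpp, hp, hpr, hp', hb, hμp⟩ := even_case hμ hrl h
    exact (dich hrl.le hpp hp hpr hp' hμ hμp).2.2 hb
  · rintro ⟨p, p', hpp, hp, hpr, hp', hb, hμp⟩
    exact (dich hrl.le hpp hp hpr hp' hμ hμp).2.1 hb
  · intro h
    obtain ⟨p, p', hpp, hp, hpr, hp', hb, hμp⟩ := odd_case hμ hrl h
    rw [h, (dich hrl.le hpp hp hpr hp' hμ hμp).1]
  · obtain ⟨b, hb⟩ : ∃ b : ↥T2, b ∉ (1 : Submodule Fq ↥T2) := by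
      by_contra! hall
      have h1 : (1 : Submodule Fq ↥T2) = ⊤ := eq_top_iff.2 fun b _ => hall b
      have h2 : Module.finrank Fq ↥(1 : Submodule Fq ↥T2) = 1 := by
        rw [Submodule.one_eq_span, finrank_span_singleton one_ne_zero]
      rw [h1, finrank_top, hT2] at h2
      omega
    have hdeg : (Polynomial.C b * Polynomial.X ^ r + 1 : Polynomial ↥T2).natDegree ≤ r :=
      Polynomial.natDegree_add_le_of_degree_le (Polynomial.natDegree_C_mul_X_pow_le b r)
        (by simp)
    have hcoeff : (Polynomial.C b * Polynomial.X ^ r + 1 : Polynomial ↥T2).coeff r = b := by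
      have hr0 : r ≠ 0 := by omega
      simp [Polynomial.coeff_one, hr0]
    have hcop : IsCoprime (Polynomial.X ^ r) (Polynomial.C b * Polynomial.X ^ r + 1) :=
      ⟨-Polynomial.C b, 1, by ring⟩
    have hμ : Polynomial.aeval lam (Polynomial.X ^ r : Polynomial ↥T2) /
        Polynomial.aeval lam (Polynomial.C b * Polynomial.X ^ r + 1 : Polynomial ↥T2) ≠ 0 := by
      refine div_ne_zero (fun h => ?_) (fun h => ?_)
      · exact (Polynomial.monic_X_pow r).ne_zero
          (hx _ (by rw [Polynomial.natDegree_X_pow]; omega) h)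
      · have h0 := hx _ (hdeg.trans (by omega)) h
        have := congrArg (fun f => Polynomial.coeff f 0) h0
        have hr0 : 0 ≠ r := by omega
        simp [hr0] at this
    obtain ⟨h1, -, h3⟩ := dich (by omega) hcop (Polynomial.monic_X_pow r)
      (Polynomial.natDegree_X_pow r) hdeg hμ (Or.inl rfl)
    refine ⟨_, hμ, ?_⟩
    rw [h3 (by rwa [hcoeff, hmem]), h1]
  · have hlam0 : lam ≠ 0 := fun h => hlam (h ▸ T2.zero_mem)
    refine ⟨lam ^ r, pow_ne_zero r hlam0, ?_⟩
    refine (dich hrl (p := Polynomial.X ^ r) (p' := 1) isCoprime_one_right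
      (Polynomial.monic_X_pow r) (Polynomial.natDegree_X_pow r) (by simp) (pow_ne_zero r hlam0)
      (Or.inl (by simp))).2.1 ?_
    rw [Polynomial.coeff_one, if_neg (by omega)]
    exact ⟨0, map_zero _⟩
end

section
/- Let λ ∈ F_{q^n} \ F_q with F_q(λ) = F_{q^t}, let S̄ be an F_{q^t}-subspace of F_{q^n} with dim_{F_{q^t}}(S̄) = ℓ > 0, let b ∈ F_{q^n} \ S̄, let 0 < m < t, and let S = S̄ ⊕ b·⟨1, λ, …, λ^{m−1}⟩_{F_q} ∈ G_q(n, tℓ + m). If either (t,m) ≠ (2,1), or (t,m) = (2,1) and F_{q^2} is properly contained in H(⟨S⟩_{F_{q^2}}), then Orb(S) is not a full weight spectrum code. -/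
/-!
Setting: `q` is a prime power, realized by a finite field `Fq` with `Fintype.card Fq = q`;
`F` plays the role of `F_{q^n}`: a finite field extension of `Fq` with `Module.finrank Fq F = n`.
`F_q`-subspaces of `F_{q^n}` are `Submodule Fq F`; for a divisor `t` of `n`, the subfield
`F_{q^t}` is the (unique) `T : IntermediateField Fq F` with `Module.finrank Fq ↥T = t`, and
`F_{q^t}`-subspaces are `Submodule ↥T F`.
-/

set_option synthInstance.maxHeartbeats 1000000

open FWS

namespace FWS

theorem mem_shift_s14 {R F : Type*} [Field R] [Field F] [Algebra R F] {α : F} (hα : α ≠ 0)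
    (S : Submodule R F) (x : F) : x ∈ shift R α S ↔ α⁻¹ * x ∈ S := by
  constructor
  · rintro ⟨y, hy, rfl⟩
    simpa [hα] using hy
  · intro h
    exact ⟨α⁻¹ * x, h, by simp [hα]⟩

theorem finrank_shift_s14 {R F : Type*} [Field R] [Field F] [Algebra R F] {α : F} (hα : α ≠ 0)
    (S : Submodule R F) : Module.finrank R ↥(shift R α S) = Module.finrank R ↥S :=
  (Submodule.equivMapOfInjective (LinearMap.mulLeft R α)
    (mul_right_injective₀ hα) S).finrank_eq.symm

theorem finrank_map_add_finrank_inf_ker {K V V' : Type*} [Field K] [AddCommGroup V]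
    [Module K V] [AddCommGroup V'] [Module K V'] [FiniteDimensional K V] (f : V →ₗ[K] V')
    (N : Submodule K V) :
    Module.finrank K ↥(N.map f) + Module.finrank K ↥(N ⊓ LinearMap.ker f : Submodule K V)
      = Module.finrank K ↥N := by
  have h := (f.domRestrict N).finrank_range_add_finrank_ker
  rw [LinearMap.range_domRestrict, LinearMap.ker_domRestrict] at h
  rw [← h]
  congr 1
  rw [← Submodule.map_comap_subtype]
  exact (Submodule.equivMapOfInjective _ N.injective_subtype _).finrank_eq.symm

theorem finrank_restrictScalars_eq_mul (k : Type*) {L V : Type*} [Field k] [Field L]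
    [Algebra k L] [AddCommGroup V] [Module L V] [Module k V] [IsScalarTower k L V]
    (B : Submodule L V) :
    Module.finrank k ↥(B.restrictScalars k) = Module.finrank k L * Module.finrank L ↥B :=
  (Module.finrank_mul_finrank k L ↥B).symm

/-- The dimension of the part of an `L`-space `B` that a map `G` to `L × L` sends to `W × W`,
according to the dimension `p` of the image of `B`. -/
theorem finrank_inf_comap_prod {k L V : Type*} [Field k] [Field L] [Algebra k L]
    [AddCommGroup V] [Module L V] [Module k V] [IsScalarTower k L V]
    [FiniteDimensional k L] [FiniteDimensional L V]
    (B : Submodule L V) (G : V →ₗ[L] L × L) (W : Submodule k L) (N : Submodule k V)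
    (hN : ∀ x, x ∈ N ↔ x ∈ B ∧ (G x).1 ∈ W ∧ (G x).2 ∈ W) :
    ∃ p : ℕ, Module.finrank L ↥B
        = Module.finrank L ↥(B ⊓ LinearMap.ker G : Submodule L V) + p ∧ p ≤ 2 ∧
      ∃ c : ℕ, Module.finrank k ↥N = Module.finrank k L *
          Module.finrank L ↥(B ⊓ LinearMap.ker G : Submodule L V) + c ∧
        (p = 0 → c = 0) ∧
        (p = 1 → c ≤ Module.finrank k ↥W ∧
          2 * Module.finrank k ↥W ≤ c + Module.finrank k L) ∧
        (p = 2 → c = 2 * Module.finrank k ↥W) := by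
  have : FiniteDimensional k V := FiniteDimensional.trans k L V
  set P : Submodule L (L × L) := B.map G with hP
  have hBP := finrank_map_add_finrank_inf_ker G B
  rw [← hP] at hBP
  have hPle : Module.finrank L ↥P ≤ 2 := by
    refine (Submodule.finrank_le P).trans ?_
    simp
  have hmap : N.map (G.restrictScalars k) = P.restrictScalars k ⊓ W.prod W := by
    ext y
    constructor
    · rintro ⟨x, hx, rfl⟩
      obtain ⟨h1, h2, h3⟩ := (hN x).1 hx
      exact ⟨⟨x, h1, rfl⟩, h2, h3⟩
    · rintro ⟨⟨x, hx, rfl⟩, h2, h3⟩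
      exact ⟨x, (hN x).2 ⟨hx, h2, h3⟩, rfl⟩
  have hker : N ⊓ LinearMap.ker (G.restrictScalars k)
      = (B ⊓ LinearMap.ker G).restrictScalars k := by
    ext y
    simp only [Submodule.mem_inf, hN, LinearMap.mem_ker, LinearMap.coe_restrictScalars,
      Submodule.restrictScalars_mem]
    constructor
    · rintro ⟨⟨h1, -, -⟩, h2⟩
      exact ⟨h1, h2⟩
    · rintro ⟨h1, h2⟩
      exact ⟨⟨h1, by simp [h2], by simp [h2]⟩, h2⟩
  have hd := finrank_map_add_finrank_inf_ker (G.restrictScalars k) N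
  rw [hmap, hker, finrank_restrictScalars_eq_mul] at hd
  have hPk := finrank_restrictScalars_eq_mul k P
  have hWW : Module.finrank k ↥(W.prod W) = 2 * Module.finrank k ↥W := by
    have h := LinearMap.finrank_range_of_inj (f := LinearMap.prodMap W.subtype W.subtype)
      (Function.Injective.prodMap W.injective_subtype W.injective_subtype)
    rw [LinearMap.range_prodMap, Submodule.range_subtype, Module.finrank_prod] at h
    omega
  refine ⟨Module.finrank L ↥P, by omega, hPle, _, by rw [← hd, add_comm], ?_, ?_, ?_⟩
  · intro h
    have : P = ⊥ := Submodule.finrank_eq_zero.1 h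
    simp [this]
  · intro h
    constructor
    · have bound : ∀ f : L × L →ₗ[L] L, (∀ y ∈ W.prod W, f y ∈ W) → P ⊓ LinearMap.ker f = ⊥ →
          Module.finrank k ↥(P.restrictScalars k ⊓ W.prod W) ≤ Module.finrank k ↥W := by
        intro f hf hPf
        have h1 := finrank_map_add_finrank_inf_ker (f.restrictScalars k)
          (P.restrictScalars k ⊓ W.prod W)
        have h2 : (P.restrictScalars k ⊓ W.prod W) ⊓ LinearMap.ker (f.restrictScalars k) = ⊥ := by
          rw [eq_bot_iff]
          rintro y ⟨⟨hy, -⟩, hy'⟩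
          have : y ∈ P ⊓ LinearMap.ker f := ⟨hy, hy'⟩
          rwa [hPf] at this
        rw [h2, finrank_bot, add_zero] at h1
        rw [← h1]
        apply Submodule.finrank_mono
        rintro _ ⟨y, hy, rfl⟩
        exact hf y hy.2
      by_cases hfst : ∃ y ∈ P, y.1 ≠ 0
      · obtain ⟨y, hy, hy1⟩ := hfst
        refine bound (LinearMap.fst L L L) (fun y hy => hy.1) ?_
        have h1 := finrank_map_add_finrank_inf_ker (LinearMap.fst L L L) P
        have h2 : P.map (LinearMap.fst L L L) ≠ ⊥ := fun h0 => hy1 <| by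
          have : y.1 ∈ P.map (LinearMap.fst L L L) := ⟨y, hy, rfl⟩
          rwa [h0] at this
        have h3 := Submodule.one_le_finrank_iff.2 h2
        exact Submodule.finrank_eq_zero.1 (by omega)
      · push Not at hfst
        refine bound (LinearMap.snd L L L) (fun y hy => hy.2) ?_
        rw [eq_bot_iff]
        rintro y ⟨hy, hy'⟩
        exact (Submodule.mem_bot L).2 (Prod.ext (hfst y hy) hy')
    · have h1 := Submodule.finrank_sup_add_finrank_inf_eq (P.restrictScalars k) (W.prod W)
      have h2 := Submodule.finrank_le (P.restrictScalars k ⊔ W.prod W)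
      have h3 : Module.finrank k (L × L) = 2 * Module.finrank k L := by
        rw [Module.finrank_prod]; ring
      rw [hPk, h] at h1
      omega
  · intro h
    have : P = ⊤ := Submodule.eq_top_of_finrank_eq (by simp [h])
    rw [this, Submodule.restrictScalars_top, top_inf_eq, hWW]

/-- If `A` is stable under multiplication by some element outside `L`, then the `L`-dimensions
of all the intersections `A ⊓ β A` share a common factor `e ≥ 2`. -/
theorem exists_dvd_finrank_inf_shift {L F : Type*} [Field L] [Field F] [Algebra L F]
    [FiniteDimensional L F] (A : Submodule L F) (α : F)
    (hα : α ∉ Set.range (algebraMap L F)) (hA : ∀ a ∈ A, α * a ∈ A) :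
    ∃ e : ℕ, 2 ≤ e ∧ e ∣ Module.finrank L ↥A ∧
      ∀ β : F, e ∣ Module.finrank L ↥(A ⊓ shift L β A) := by
  set K : IntermediateField L F := IntermediateField.adjoin L {α} with hK
  have hKA : ∀ x ∈ K, ∀ a ∈ A, x * a ∈ A := by
    intro x hx
    rw [← IntermediateField.mem_toSubalgebra, hK,
      IntermediateField.adjoin_simple_toSubalgebra_of_isAlgebraic
        (Algebra.IsAlgebraic.isAlgebraic α)] at hx
    induction hx using Algebra.adjoin_induction with
    | mem x hx =>
      rw [Set.mem_singleton_iff.1 hx]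
      exact hA
    | algebraMap r =>
      intro a ha
      rw [← Algebra.smul_def]
      exact A.smul_mem r ha
    | add x y _ _ hx hy =>
      intro a ha
      rw [add_mul]
      exact A.add_mem (hx a ha) (hy a ha)
    | mul x y _ _ hx hy =>
      intro a ha
      rw [mul_assoc]
      exact hx _ (hy a ha)
  have key : ∀ B : Submodule L F, (∀ x ∈ K, ∀ a ∈ B, x * a ∈ B) →
      Module.finrank L ↥K ∣ Module.finrank L ↥B := by
    intro B hB
    let B' : Submodule ↥K F :=
      { carrier := B
        add_mem' := fun h1 h2 => B.add_mem h1 h2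
        zero_mem' := B.zero_mem
        smul_mem' := fun c x hx => hB c c.2 x hx }
    have h : Module.finrank L ↥(B'.restrictScalars L)
        = Module.finrank L ↥K * Module.finrank ↥K ↥B' := finrank_restrictScalars_eq_mul L B'
    have h' : B'.restrictScalars L = B := rfl
    rw [h'] at h
    exact ⟨_, h⟩
  refine ⟨Module.finrank L ↥K, ?_, key A hKA, fun β => key _ ?_⟩
  · have h0 : 0 < Module.finrank L ↥K := Module.finrank_pos
    have h1 : Module.finrank L ↥K ≠ 1 := by
      intro h
      rw [IntermediateField.finrank_eq_one_iff, hK,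
        IntermediateField.adjoin_simple_eq_bot_iff] at h
      exact hα (IntermediateField.mem_bot.1 h)
    omega
  · rintro x hx a ⟨ha, y, hy, rfl⟩
    refine ⟨hKA x hx _ ha, x * y, hKA x hx y hy, ?_⟩
    simp only [LinearMap.mulLeft_apply]
    ring

theorem exists_finrank_inf_shift_of_isFWS {R F : Type*} [Field R] [Field F] [Algebra R F]
    [FiniteDimensional R F] {S : Submodule R F} (h : IsFWS R S) {d : ℕ}
    (hd : d < Module.finrank R ↥S) :
    ∃ α : F, α ≠ 0 ∧ Module.finrank R ↥(S ⊓ shift R α S) = d := by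
  have h1 := h (Module.finrank R ↥S - d) (by omega) (by omega)
  obtain ⟨⟨U, ⟨α, hα, rfl⟩, hU⟩⟩ := (Nat.card_pos_iff.1 h1).1
  refine ⟨α, hα, ?_⟩
  rw [sdist, finrank_shift_s14 hα] at hU
  have := Submodule.finrank_mono (inf_le_left : S ⊓ shift R α S ≤ S)
  omega

theorem shift_eq_self_of_finrank_inf {R F : Type*} [Field R] [Field F] [Algebra R F]
    [FiniteDimensional R F] {A : Submodule R F} {α : F} (hα : α ≠ 0)
    (h : Module.finrank R ↥(A ⊓ shift R α A) = Module.finrank R ↥A) : shift R α A = A := by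
  have h1 : A ⊓ shift R α A = A := Submodule.eq_of_le_of_finrank_eq inf_le_left h
  exact (Submodule.eq_of_le_of_finrank_eq (inf_eq_left.1 h1) (finrank_shift_s14 hα A).symm).symm

theorem shift_algebraMap {R F : Type*} [Field R] [Field F] [Algebra R F]
    (A : Submodule R F) {c : R} (hc : algebraMap R F c ≠ 0) :
    shift R (algebraMap R F c) A = A := by
  ext x
  rw [mem_shift_s14 hc, ← map_inv₀, ← Algebra.smul_def]
  refine Submodule.smul_mem_iff _ (inv_ne_zero ?_)
  rintro rfl
  simp at hc

/-- Dimensions attached to `S = Sbar ⊕ W b`, where `Sbar` is an `L`-space and `W ⊆ L` is a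
`k`-space: here `r` is the `L`-dimension of `Sbar ∩ α Sbar`, and `p` is its codimension in
`A ∩ α A`, where `A` is the `L`-span of `S`. -/
theorem finrank_inf_shift_layers {k L F : Type*} [Field k] [Field L] [Field F] [Algebra k L]
    [Algebra L F] [Algebra k F] [IsScalarTower k L F] [FiniteDimensional k L]
    [FiniteDimensional L F] (Sbar : Submodule L F) (b : F) (hb : b ∉ Sbar)
    (W : Submodule k L) (S : Submodule k F)
    (hS : ∀ x, x ∈ S ↔ ∃ s ∈ Sbar, ∃ w ∈ W, s + w • b = x) :
    Module.finrank L ↥(Sbar ⊔ Submodule.span L {b}) = Module.finrank L ↥Sbar + 1 ∧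
    Module.finrank k ↥S
      = Module.finrank k L * Module.finrank L ↥Sbar + Module.finrank k ↥W ∧
    ∀ α : F, α ≠ 0 → ∃ p c : ℕ,
      Module.finrank L ↥((Sbar ⊔ Submodule.span L {b}) ⊓
          shift L α (Sbar ⊔ Submodule.span L {b}))
        = Module.finrank L ↥(Sbar ⊓ shift L α Sbar) + p ∧ p ≤ 2 ∧
      Module.finrank k ↥(S ⊓ shift k α S)
        = Module.finrank k L * Module.finrank L ↥(Sbar ⊓ shift L α Sbar) + c ∧
      (p = 0 → c = 0) ∧
      (p = 1 → c ≤ Module.finrank k ↥W ∧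
        2 * Module.finrank k ↥W ≤ c + Module.finrank k L) ∧
      (p = 2 → c = 2 * Module.finrank k ↥W) := by
  have : FiniteDimensional k F := FiniteDimensional.trans k L F
  obtain ⟨φ, hφb, hφ⟩ : ∃ φ : F →ₗ[L] L, φ b = 1 ∧ ∀ x ∈ Sbar, φ x = 0 := by
    obtain ⟨φ₀, hφ₀b, hφ₀⟩ := Submodule.exists_le_ker_of_notMem hb
    refine ⟨(φ₀ b)⁻¹ • φ₀, by simp [hφ₀b], fun x hx => ?_⟩
    simp [LinearMap.mem_ker.1 (hφ₀ hx)]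
  set A : Submodule L F := Sbar ⊔ Submodule.span L {b} with hA
  have hSbarA : Sbar ≤ A := le_sup_left
  have hbA : b ∈ A := (le_sup_right : _ ≤ A) (Submodule.mem_span_singleton_self b)
  have hAdecomp : ∀ x ∈ A, x - φ x • b ∈ Sbar := by
    intro x hx
    obtain ⟨s, hs, y, hy, rfl⟩ := Submodule.mem_sup.1 hx
    obtain ⟨c, rfl⟩ := Submodule.mem_span_singleton.1 hy
    simpa [hφ s hs, hφb] using hs
  have hker : ∀ x, x ∈ Sbar ↔ x ∈ A ∧ φ x = 0 := fun x =>
    ⟨fun hx => ⟨hSbarA hx, hφ x hx⟩, fun ⟨hx, h0⟩ => by simpa [h0] using hAdecomp x hx⟩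
  have hSmem : ∀ x, x ∈ S ↔ x ∈ A ∧ φ x ∈ W := by
    intro x
    rw [hS]
    constructor
    · rintro ⟨s, hs, w, hw, rfl⟩
      refine ⟨A.add_mem (hSbarA hs) (A.smul_mem _ hbA), ?_⟩
      simpa [hφb, hφ s hs] using hw
    · rintro ⟨hx, hw⟩
      exact ⟨x - φ x • b, hAdecomp x hx, φ x, hw, by abel⟩
  refine ⟨?_, ?_, ?_⟩
  · have h1 := finrank_map_add_finrank_inf_ker φ A
    have h2 : A ⊓ LinearMap.ker φ = Sbar := by
      ext x
      exact (hker x).symm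
    have h3 : A.map φ = ⊤ := by
      rw [eq_top_iff]
      intro c _
      exact ⟨c • b, A.smul_mem c hbA, by simp [hφb]⟩
    rw [h2, h3, finrank_top, Module.finrank_self] at h1
    omega
  · have h1 := finrank_map_add_finrank_inf_ker (φ.restrictScalars k) S
    have h2 : S ⊓ LinearMap.ker (φ.restrictScalars k) = Sbar.restrictScalars k := by
      ext x
      refine ⟨fun ⟨hx, h0⟩ => (hker x).2 ⟨((hSmem x).1 hx).1, h0⟩, fun hx => ⟨?_, hφ x hx⟩⟩
      exact (hSmem x).2 ⟨hSbarA hx, by rw [hφ x hx]; exact W.zero_mem⟩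
    have h3 : S.map (φ.restrictScalars k) = W := by
      ext c
      constructor
      · rintro ⟨x, hx, rfl⟩
        exact ((hSmem x).1 hx).2
      · intro hc
        have h : φ (c • b) = c := by simp [hφb]
        exact ⟨c • b, (hSmem _).2 ⟨A.smul_mem c hbA, by rwa [h]⟩, h⟩
    rw [h2, h3, finrank_restrictScalars_eq_mul] at h1
    omega
  · intro α hα
    set G : F →ₗ[L] L × L := φ.prod (φ ∘ₗ LinearMap.mulLeft L α⁻¹) with hG
    have hG1 : ∀ x, (G x).1 = φ x := fun x => rfl
    have hG2 : ∀ x, (G x).2 = φ (α⁻¹ * x) := fun x => rfl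
    have hGker : (A ⊓ shift L α A) ⊓ LinearMap.ker G = Sbar ⊓ shift L α Sbar := by
      ext x
      rw [Submodule.mem_inf, Submodule.mem_inf, Submodule.mem_inf, mem_shift_s14 hα, mem_shift_s14 hα,
        LinearMap.mem_ker, hker, hker (α⁻¹ * x), Prod.ext_iff, hG1, hG2, and_and_and_comm]
      rfl
    have h := finrank_inf_comap_prod (A ⊓ shift L α A) G W (S ⊓ shift k α S) (by
      intro x
      rw [Submodule.mem_inf, Submodule.mem_inf, mem_shift_s14 hα, mem_shift_s14 hα,
        hSmem, hSmem (α⁻¹ * x), hG1, hG2, and_and_and_comm])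
    rw [hGker] at h
    obtain ⟨p, h1, h2, c, h3⟩ := h
    exact ⟨p, c, h1, h2, h3⟩

end FWS

/-- Theorem 6.1: codes from Family ii) are not FWS, except possibly when
`(t, m) = (2, 1)` and `H(⟨S⟩_{F_{q^2}}) = F_{q^2}`. -/
theorem family_ii_not_FWS
    {Fq F : Type*} [Field Fq] [Field F] [Algebra Fq F] [Fintype Fq] [Fintype F]
    (q n t : ℕ) (hq : Fintype.card Fq = q) (hn : Module.finrank Fq F = n)
    (lam : F) (hlam : lam ∉ Set.range (algebraMap Fq F))
    (T : IntermediateField Fq F) (hTlam : IntermediateField.adjoin Fq {lam} = T)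
    (hT : Module.finrank Fq ↥T = t)
    (Sbar : Submodule ↥T F) (el : ℕ) (hSbar : Module.finrank ↥T ↥Sbar = el) (hel : 0 < el)
    (b : F) (hb : b ∉ Sbar)
    (m : ℕ) (hm0 : 0 < m) (hmt : m < t)
    (S : Submodule Fq F)
    (hS : S = Sbar.restrictScalars Fq ⊔ shift Fq b (polySpan Fq lam m))
    (hSk : Module.finrank Fq ↥S = t * el + m)
    (hcase : (t, m) ≠ (2, 1) ∨
      ((t, m) = (2, 1) ∧
        (T : Set F) ⊂ stab ((Submodule.span ↥T (S : Set F) : Submodule ↥T F) : Set F))) :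
    ¬ IsFWS Fq S := by
  have hfd : FiniteDimensional Fq F := .of_finite
  have hpoly : ∀ w ∈ polySpan Fq lam m, w ∈ T := by
    have h : polySpan Fq lam m ≤ Subalgebra.toSubmodule T.toSubalgebra := by
      refine Submodule.span_le.2 ?_
      rintro _ ⟨i, -, rfl⟩
      have : lam ∈ T := hTlam ▸ IntermediateField.mem_adjoin_simple_self Fq lam
      exact pow_mem this i
    exact fun w hw => h hw
  have hSmem : ∀ x, x ∈ S ↔ ∃ s ∈ Sbar,
      ∃ w ∈ (polySpan Fq lam m).comap T.val.toLinearMap, s + w • b = x := by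
    intro x
    rw [hS]
    constructor
    · intro hx
      obtain ⟨s, hs, y, ⟨w, hw, rfl⟩, rfl⟩ := Submodule.mem_sup.1 hx
      exact ⟨s, hs, ⟨w, hpoly w hw⟩, hw, congrArg (s + ·) (mul_comm w b)⟩
    · rintro ⟨s, hs, w, hw, rfl⟩
      exact Submodule.mem_sup.2 ⟨s, hs, w • b, ⟨w, hw, mul_comm b (w : F)⟩, rfl⟩
  obtain ⟨hAdim, hWdim, hlayers⟩ := finrank_inf_shift_layers Sbar b hb _ S hSmem
  rw [hT] at hWdim hlayers
  rw [hSbar] at hAdim hWdim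
  set A : Submodule ↥T F := Sbar ⊔ Submodule.span ↥T {b} with hA
  replace hWdim := Nat.add_left_cancel (hWdim.symm.trans hSk)
  rw [hWdim] at hlayers
  have core : ∀ α : F, α ≠ 0 → ∃ r p c : ℕ,
      Module.finrank ↥T ↥(Sbar ⊓ shift ↥T α Sbar) = r ∧ r ≤ el ∧
      Module.finrank ↥T ↥(A ⊓ shift ↥T α A) = r + p ∧ r + p ≤ el + 1 ∧ p ≤ 2 ∧
      Module.finrank Fq ↥(S ⊓ shift Fq α S) = t * r + c ∧ (p = 0 → c = 0) ∧
      (p = 1 → c ≤ m ∧ 2 * m ≤ c + t) ∧ (p = 2 → c = 2 * m) := by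
    intro α hα
    obtain ⟨p, c, h1, h2, h3, h4⟩ := hlayers α hα
    have h5 := Submodule.finrank_mono (inf_le_left : Sbar ⊓ shift ↥T α Sbar ≤ Sbar)
    have h6 := Submodule.finrank_mono (inf_le_left : A ⊓ shift ↥T α A ≤ A)
    exact ⟨_, p, c, rfl, by omega, h1, by omega, h2, h3, h4⟩
  intro hFWS
  have hatt : ∀ d, d < t * el + m → ∃ α : F, α ≠ 0 ∧
      Module.finrank Fq ↥(S ⊓ shift Fq α S) = d := fun d hd =>
    exists_finrank_inf_shift_of_isFWS hFWS (hSk ▸ hd)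
  have hstable : ∀ (B : Submodule ↥T F) (α : F), α ∉ T → shift ↥T α B = B →
      ∃ e : ℕ, 2 ≤ e ∧ e ∣ Module.finrank ↥T ↥B ∧
        ∀ β : F, e ∣ Module.finrank ↥T ↥(B ⊓ shift ↥T β B) := by
    intro B α hα hB
    refine exists_dvd_finrank_inf_shift B α ?_ ?_
    · rintro ⟨c, rfl⟩
      exact hα c.2
    · intro a ha
      rw [← hB]
      exact ⟨a, ha, rfl⟩
  have hTshift : ∀ (B : Submodule ↥T F) (α : F), α ≠ 0 → α ∈ T → shift ↥T α B = B :=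
    fun B α hα hαT => shift_algebraMap B (c := ⟨α, hαT⟩) hα
  have hconsec : ∀ e l : ℕ, 2 ≤ e → e ∣ l + 1 → ¬ e ∣ l := by
    intro e l he h1 h2
    have := Nat.le_of_dvd one_pos ((Nat.dvd_add_right h2).1 h1)
    omega
  obtain ⟨l, rfl⟩ : ∃ l, el = l + 1 := ⟨el - 1, by omega⟩
  have hr : ∀ r : ℕ, r ≤ l + 1 → r = l + 1 ∨ r = l ∨ t * r + t ≤ t * l := by
    intro r hrl
    by_cases h : r < l
    · exact Or.inr (Or.inr (Nat.mul_le_mul_left t h))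
    · omega
  have hl : t * (l + 1) = t * l + t := by ring
  rw [hl] at hatt
  -- a dimension strictly between `m` and `t`, other than `2 * m`, above the layer `l`
  have hgap : ∀ c₀, m < c₀ → c₀ < t → c₀ = 2 * m := by
    intro c₀ h1 h2
    by_contra h3
    obtain ⟨α, hα, hd⟩ := hatt (t * l + c₀) (by omega)
    obtain ⟨r, p, c, -, hrl, -, -, hp, hd', hp0, hp1, hp2⟩ := core α hα
    rw [hd] at hd'
    rcases hr r hrl with rfl | rfl | h <;> interval_cases p <;> omega
  rcases Nat.lt_or_ge (m + 1) t with hm | hm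
  · have h1 := hgap (m + 1) (by omega) hm
    obtain rfl : m = 1 := by omega
    obtain rfl : t = 3 := by
      by_contra h
      have := hgap 3 (by omega) (by omega)
      omega
    obtain ⟨α, hα, hd⟩ := hatt (3 * l + 2) (by omega)
    obtain ⟨r, p, c, hr1, hrl, ha, hal, hp, hd', hp0, hp1, hp2⟩ := core α hα
    have h2 : p = 2 ∧ r = l := by interval_cases p <;> omega
    obtain ⟨rfl, rfl⟩ := h2
    have hAA := shift_eq_self_of_finrank_inf hα (ha.trans hAdim.symm)
    have hαT : α ∉ T := by
      intro h
      rw [hTshift Sbar α hα h, inf_idem, hSbar] at hr1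
      omega
    obtain ⟨e, he, hdvd, hall⟩ := hstable A α hαT hAA
    obtain ⟨β, hβ, hd⟩ := hatt (3 * r + 1) (by omega)
    obtain ⟨r', p, c, -, hrl', ha', -, hp, hd', hp0, hp1, hp2⟩ := core β hβ
    have h3 := hall β
    have h4 : r' + p = r + 1 := by interval_cases p <;> omega
    rw [ha', h4] at h3
    rw [hAdim] at hdvd
    exact hconsec e (r + 1) he hdvd h3
  · obtain rfl : t = m + 1 := by omega
    have hm3 : m < 3 := by
      by_contra h
      obtain ⟨α, hα, hd⟩ := hatt ((m + 1) * l + (m + 1) + 1) (by omega)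
      obtain ⟨r, p, c, -, hrl, -, hal, hp, hd', hp0, hp1, hp2⟩ := core α hα
      rw [hd] at hd'
      rcases hr r hrl with rfl | rfl | h
      · rw [hl] at hd'
        interval_cases p <;> omega
      · interval_cases p <;> omega
      · interval_cases p <;> omega
    interval_cases m
    · obtain ⟨-, hsub⟩ := hcase.resolve_left (by simp)
      obtain ⟨α, hαs, hαT⟩ := Set.exists_of_ssubset hsub
      have hspan : Submodule.span ↥T (S : Set F) = A := by
        apply le_antisymm
        · exact Submodule.span_le.2 fun x hx => by
            obtain ⟨s, hs, w, -, rfl⟩ := (hSmem x).1 hx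
            exact Submodule.add_mem_sup hs (Submodule.smul_mem _ w (Submodule.mem_span_singleton_self b))
        · refine sup_le (fun x hx => Submodule.subset_span ?_) ?_
          · rw [hS]
            exact Submodule.mem_sup_left hx
          · rw [Submodule.span_singleton_le_iff_mem]
            refine Submodule.subset_span ?_
            rw [hS]
            exact Submodule.mem_sup_right ⟨1, Submodule.subset_span ⟨0, by simp, by simp⟩, by simp⟩
      rw [hspan] at hαs
      have hα0 : α ≠ 0 := fun h => hαT (h ▸ T.zero_mem)
      obtain ⟨-, himg⟩ := hαs.resolve_right hα0
      obtain ⟨e, he, hdvd, hall⟩ := hstable A α hαT (SetLike.coe_injective himg)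
      obtain ⟨β, hβ, hd⟩ := hatt (2 * l + 1) (by omega)
      obtain ⟨r', p, c, -, hrl', ha', -, hp, hd', hp0, hp1, hp2⟩ := core β hβ
      have h3 := hall β
      have h4 : r' + p = l + 1 := by interval_cases p <;> omega
      rw [ha', h4] at h3
      rw [hAdim] at hdvd
      exact hconsec e (l + 1) he hdvd h3
    · obtain ⟨α, hα, hd⟩ := hatt (3 * l + 3) (by omega)
      obtain ⟨r, p, c, hr1, hrl, ha, hal, hp, hd', hp0, hp1, hp2⟩ := core α hα
      have h2 : p = 0 ∧ r = l + 1 := by interval_cases p <;> omega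
      obtain ⟨rfl, rfl⟩ := h2
      have hBB := shift_eq_self_of_finrank_inf hα (hr1.trans hSbar.symm)
      have hαT : α ∉ T := by
        intro h
        rw [hTshift A α hα h, inf_idem, hAdim] at ha
        omega
      obtain ⟨e, he, hdvd, hall⟩ := hstable Sbar α hαT hBB
      obtain ⟨β, hβ, hd⟩ := hatt (3 * l + 2) (by omega)
      obtain ⟨r', p, c, hr', hrl', ha', -, hp, hd', hp0, hp1, hp2⟩ := core β hβ
      have h3 := hall β
      have h4 : r' = l := by interval_cases p <;> omega
      rw [hr', h4] at h3
      rw [hSbar] at hdvd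
      exact hconsec e l he hdvd h3
end
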